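/- Let D ⊂ ℝⁿ be a bounded open convex domain, p(z) = inf{t > 0 : x + t⁻¹y ∈ D} for z = x+iy with x ∈ D, D^ell the elliptic tube over D, and u(z) = (arctan p(z) + arctan p(z̄))/2 the associated maximal function. Then for every x ∈ D and y ∈ ℝⁿ = T_xD, setting z = x + iy, one has E_{u,D^ell}(x,y) = E_{D,D^ell}(x,y) = F_{D,D^ell}(x,y) = (p(z) + p(z̄))/2. -/

import Mathlib

open Metric Filter Complex Set

variable (n : ℕ)

/-- The canonical inclusion `ℝⁿ ⊆ ℂⁿ`. -/
def reC (x : Fin n → ℝ) : Fin n → ℂ := fun i => (x i : ℂ)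

/-- Imaginary part `Im : ℂⁿ → ℝⁿ`. -/
def imPart (z : Fin n → ℂ) : Fin n → ℝ := fun i => (z i).im

/-- Real part `Re : ℂⁿ → ℝⁿ`. -/
def rePart (z : Fin n → ℂ) : Fin n → ℝ := fun i => (z i).re

/-- A function `u : ℂⁿ → ℝ` is *plurisubharmonic* on `Ω ⊆ ℂⁿ` if it is upper
semicontinuous on `Ω` and satisfies the sub-mean-value inequality on every closed disc
of every complex line contained in `Ω`. -/
def PlurisubharmonicOn (u : (Fin n → ℂ) → ℝ) (Ω : Set (Fin n → ℂ)) : Prop :=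
  UpperSemicontinuousOn u Ω ∧
    ∀ a b : Fin n → ℂ, ∀ c : ℂ, ∀ r : ℝ, 0 < r →
      (∀ ζ ∈ closedBall c r, a + ζ • b ∈ Ω) →
      u (a + c • b) ≤
        (2 * Real.pi)⁻¹ * ∫ θ in (0:ℝ)..(2 * Real.pi), u (a + circleMap c r θ • b)

/-- The class `𝒰(ℝⁿ ∩ X, X)`: plurisubharmonic functions `u : X → [0, π/4)` vanishing
at the real points of `X`. -/
def MemPSHU (X : Set (Fin n → ℂ)) (u : (Fin n → ℂ) → ℝ) : Prop :=
  PlurisubharmonicOn n u X ∧ (∀ z ∈ X, 0 ≤ u z ∧ u z < Real.pi / 4) ∧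
    ∀ x : Fin n → ℝ, reC n x ∈ X → u (reC n x) = 0

/-- `E_{u,X}(x, ξ)`: the infimum, over `C¹` curves `γ : (-ε, ε) → X` with `γ 0 = x` and
`γ' 0 = i·ξ`, of `limsup_{t→0⁺} u (γ t)/t` (computed in `EReal`). -/
noncomputable def EInf (X : Set (Fin n → ℂ)) (u : (Fin n → ℂ) → ℝ)
    (x ξ : Fin n → ℝ) : EReal :=
  sInf {L : EReal | ∃ ε : ℝ, 0 < ε ∧ ∃ γ : ℝ → Fin n → ℂ,
    ContDiffOn ℝ 1 γ (Set.Ioo (-ε) ε) ∧ (∀ t ∈ Set.Ioo (-ε) ε, γ t ∈ X) ∧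
    γ 0 = reC n x ∧ HasDerivAt γ (Complex.I • reC n ξ) 0 ∧
    L = limsup (fun t : ℝ => ((u (γ t) / t : ℝ) : EReal)) (nhdsWithin 0 (Set.Ioi 0))}

/-- `E_{ℝⁿ,X}(x, ξ) = sup_{u ∈ 𝒰} E_{u,X}(x, ξ)`. -/
noncomputable def ESup (X : Set (Fin n → ℂ)) (x ξ : Fin n → ℝ) : EReal :=
  ⨆ u ∈ {u : (Fin n → ℂ) → ℝ | MemPSHU n X u}, EInf n X u x ξ

/-- Componentwise complex conjugation on `ℂⁿ`. -/
def conjC (z : Fin n → ℂ) : Fin n → ℂ := fun i => (starRingEnd ℂ) (z i)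

/-- The Minkowski functional of `D` centered at `x`, evaluated at `y`:
`p = inf {t > 0 : x + t⁻¹ y ∈ D}`. -/
noncomputable def mink (D : Set (Fin n → ℝ)) (x y : Fin n → ℝ) : ℝ :=
  sInf {t : ℝ | 0 < t ∧ x + t⁻¹ • y ∈ D}

/-- `p(z)`: the Minkowski functional of `D` centered at `Re z` evaluated at `Im z`. -/
noncomputable def minkP (D : Set (Fin n → ℝ)) (z : Fin n → ℂ) : ℝ :=
  mink n D (rePart n z) (imPart n z)

/-- The *elliptic tube* over a convex set `D ⊆ ℝⁿ` (Lempert):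
`D^ell = {z = x + iy : x ∈ D, p(z)·p(z̄) < 1}`. -/
def ellTube (D : Set (Fin n → ℝ)) : Set (Fin n → ℂ) :=
  {z : Fin n → ℂ | rePart n z ∈ D ∧ minkP n D z * minkP n D (conjC n z) < 1}

/-- The candidate maximal function on the elliptic tube:
`u(z) = (arctan p(z) + arctan p(z̄)) / 2`. -/
noncomputable def ellTubeU (D : Set (Fin n → ℝ)) (z : Fin n → ℂ) : ℝ :=
  (Real.arctan (minkP n D z) + Real.arctan (minkP n D (conjC n z))) / 2

/-- For a locally bounded plurisubharmonic function `u`, the homogeneous complex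
Monge–Ampère equation `(dd^c u)^n = 0` on an open set `Ω ⊆ ℂⁿ`, in the sense of
Bedford–Taylor, holds if and only if `u` is a *maximal* plurisubharmonic function on
`Ω` (Bedford–Taylor, Sadullaev); we take this equivalent characterization as the
definition. -/
def MongeAmpereZeroOn (u : (Fin n → ℂ) → ℝ) (Ω : Set (Fin n → ℂ)) : Prop :=
  ∀ G : Set (Fin n → ℂ), IsOpen G → closure G ⊆ Ω → IsCompact (closure G) →
    ∀ v : (Fin n → ℂ) → ℝ, PlurisubharmonicOn n v G →
      (∀ q ∈ frontier G,
        limsup (fun x => (v x : EReal)) (nhdsWithin q G) ≤ (u q : EReal)) →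
      ∀ q ∈ G, v q ≤ u q

/-- `F_{D,X}(x, ξ)`: the infimum of all `a > 0` such that there exists a holomorphic
disc `f : Δ → X` with `f((-1,1)) ⊆ D`, `f 0 = x` and `f' 0 = a⁻¹ ξ`. -/
noncomputable def FInf (D : Set (Fin n → ℝ)) (X : Set (Fin n → ℂ))
    (x ξ : Fin n → ℝ) : EReal :=
  sInf {L : EReal | ∃ a : ℝ, 0 < a ∧ L = (a : EReal) ∧ ∃ f : ℂ → Fin n → ℂ,
    DifferentiableOn ℂ f (ball (0 : ℂ) 1) ∧ (∀ ζ ∈ ball (0 : ℂ) 1, f ζ ∈ X) ∧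
    (∀ t : ℝ, t ∈ Set.Ioo (-1 : ℝ) 1 → f (t : ℂ) ∈ reC n '' D) ∧
    f 0 = reC n x ∧ HasDerivAt f (a⁻¹ • reC n ξ) 0}


section helpers

variable {n}

lemma mink_nonneg' (D : Set (Fin n → ℝ)) (x y : Fin n → ℝ) : 0 ≤ mink n D x y :=
  Real.sInf_nonneg fun _ ht => ht.1.le

lemma mink_le' {D : Set (Fin n → ℝ)} {x y : Fin n → ℝ} {t : ℝ} (ht : 0 < t)
    (h : x + t⁻¹ • y ∈ D) : mink n D x y ≤ t :=
  csInf_le ⟨0, fun _ hs => hs.1.le⟩ ⟨ht, h⟩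

lemma mink_set_nonempty {D : Set (Fin n → ℝ)} (hDopen : IsOpen D) {x : Fin n → ℝ} (hx : x ∈ D)
    (y : Fin n → ℝ) : {t : ℝ | 0 < t ∧ x + t⁻¹ • y ∈ D}.Nonempty := by
  have hc : Tendsto (fun t : ℝ => x + t⁻¹ • y) atTop (nhds (x + (0:ℝ) • y)) :=
    (tendsto_inv_atTop_zero.smul_const y).const_add x
  have h1 : ∀ᶠ t : ℝ in atTop, x + t⁻¹ • y ∈ D :=
    hc.eventually (hDopen.mem_nhds (by simpa using hx))
  obtain ⟨t, h2, h3⟩ := (h1.and (eventually_gt_atTop 0)).exists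
  exact ⟨t, h3, h2⟩

lemma mink_star {D : Set (Fin n → ℝ)} (hDopen : IsOpen D) (hDconv : Convex ℝ D)
    {x y : Fin n → ℝ} (hx : x ∈ D) {t : ℝ} (h : mink n D x y < t) : x + t⁻¹ • y ∈ D := by
  obtain ⟨s, ⟨hs0, hs⟩, hst⟩ := exists_lt_of_csInf_lt (mink_set_nonempty hDopen hx y) h
  have ht : 0 < t := hs0.trans hst
  have := hDconv.add_smul_mem hx hs (t := s / t) ⟨by positivity, by rw [div_le_one ht]; exact hst.le⟩
  rwa [smul_smul, show s / t * s⁻¹ = t⁻¹ by field_simp] at this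

lemma mink_zero' {D : Set (Fin n → ℝ)} {x : Fin n → ℝ} (hx : x ∈ D) : mink n D x 0 = 0 := by
  refine le_antisymm (le_of_forall_pos_le_add fun e he => ?_) (mink_nonneg' _ _ _)
  rw [zero_add]
  exact mink_le' he (by simpa using hx)

lemma mink_not_mem {D : Set (Fin n → ℝ)} (hDopen : IsOpen D)
    {x y : Fin n → ℝ} (h : 0 < mink n D x y) : x + (mink n D x y)⁻¹ • y ∉ D := by
  intro hm
  have hc : ContinuousAt (fun t : ℝ => x + t⁻¹ • y) (mink n D x y) :=
    ((continuousAt_inv₀ h.ne').smul_const y).const_add x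
  have h1 : ∀ᶠ t : ℝ in nhds (mink n D x y), x + t⁻¹ • y ∈ D := hc (hDopen.mem_nhds hm)
  have h2 := (h1.and (eventually_gt_nhds h)).filter_mono
    (nhdsWithin_le_nhds (s := Set.Iio (mink n D x y)))
  obtain ⟨t, ⟨h3, h4⟩, h5⟩ := (h2.and self_mem_nhdsWithin).exists
  exact absurd (mink_le' h4 h3) (not_le.2 h5)

lemma mink_pos' {D : Set (Fin n → ℝ)} (hDopen : IsOpen D)
    (hDbdd : Bornology.IsBounded D)
    {x y : Fin n → ℝ} (hx : x ∈ D) (hy : y ≠ 0) : 0 < mink n D x y := by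
  obtain ⟨R, hR⟩ := hDbdd.exists_norm_le
  have hy' : 0 < ‖y‖ := norm_pos_iff.2 hy
  have hR0 : 0 ≤ R := (norm_nonneg _).trans (hR x hx)
  have : ‖y‖ / (2 * R + 1) ≤ mink n D x y := by
    refine le_csInf (mink_set_nonempty hDopen hx y) ?_
    rintro t ⟨ht, hm⟩
    have h1 := hR _ hm
    have h2 := hR _ hx
    have h3 : ‖t⁻¹ • y‖ ≤ ‖x + t⁻¹ • y‖ + ‖x‖ := by
      have := norm_sub_le (x + t⁻¹ • y) x
      simpa using this
    rw [norm_smul, norm_inv, Real.norm_of_nonneg ht.le] at h3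
    have h4 : t⁻¹ * ‖y‖ ≤ 2 * R + 1 := by linarith
    rw [div_le_iff₀ (by positivity)]
    rw [inv_mul_le_iff₀ ht] at h4
    exact h4
  exact lt_of_lt_of_le (by positivity) this

lemma le_support {D : Set (Fin n → ℝ)} (hDopen : IsOpen D)
    {x : Fin n → ℝ} (hx : x ∈ D) (y : Fin n → ℝ) (l : (Fin n → ℝ) →L[ℝ] ℝ) {c : ℝ}
    (hl : ∀ a ∈ D, l a < c) : l y / (c - l x) ≤ mink n D x y := by
  refine le_csInf (mink_set_nonempty hDopen hx y) ?_
  rintro t ⟨ht, hm⟩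
  have h1 := hl _ hm
  have h2 := hl _ hx
  rw [map_add, map_smul, smul_eq_mul] at h1
  rw [div_le_iff₀ (by linarith)]
  have : t⁻¹ * l y ≤ c - l x := by linarith
  rwa [inv_mul_le_iff₀ ht] at this

lemma exists_support {D : Set (Fin n → ℝ)} (hDopen : IsOpen D) (hDconv : Convex ℝ D)
    (hDbdd : Bornology.IsBounded D)
    {x : Fin n → ℝ} (hx : x ∈ D) {y : Fin n → ℝ} (hy : y ≠ 0) :
    ∃ (l : (Fin n → ℝ) →L[ℝ] ℝ) (c : ℝ), (∀ a ∈ D, l a < c) ∧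
      l y / (c - l x) = mink n D x y := by
  have h0 := mink_pos' hDopen hDbdd hx hy
  obtain ⟨l, hl⟩ := geometric_hahn_banach_open_point hDconv hDopen (mink_not_mem hDopen h0)
  refine ⟨l, _, hl, ?_⟩
  have h2 := hl _ hx
  rw [map_add, map_smul, smul_eq_mul] at h2 ⊢
  have h3 : 0 < l y := by
    have : 0 < (mink n D x y)⁻¹ * l y := by linarith
    exact (mul_pos_iff_of_pos_left (by positivity)).1 this
  have h4 := h3.ne'
  rw [add_sub_cancel_left]
  field_simp

lemma mink_cont {D : Set (Fin n → ℝ)} (hDopen : IsOpen D) (hDconv : Convex ℝ D)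
    (hDbdd : Bornology.IsBounded D) {x : Fin n → ℝ} (hx : x ∈ D) (y : Fin n → ℝ) :
    ContinuousAt (fun q : (Fin n → ℝ) × (Fin n → ℝ) => mink n D q.1 q.2) (x, y) := by
  rw [ContinuousAt, tendsto_order]
  constructor
  · intro c hc
    simp only at hc
    by_cases hy : y = 0
    · subst hy
      rw [mink_zero' hx] at hc
      exact Eventually.of_forall fun q => hc.trans_le (mink_nonneg' _ _ _)
    · obtain ⟨l, d, hl, he⟩ := exists_support hDopen hDconv hDbdd hx hy
      have hcont : ContinuousAt (fun q : (Fin n → ℝ) × (Fin n → ℝ) => l q.2 / (d - l q.1)) (x, y) := by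
        refine ContinuousAt.div (by fun_prop) (by fun_prop) ?_
        have := hl x hx
        simp only
        linarith
      have h1 := hcont.eventually (lt_mem_nhds (a := c) (by simp only; rw [he]; exact hc))
      have h2 : ∀ᶠ q : (Fin n → ℝ) × (Fin n → ℝ) in nhds (x, y), q.1 ∈ D :=
        continuousAt_fst (hDopen.mem_nhds hx)
      filter_upwards [h1, h2] with q h3 h4
      exact h3.trans_le (le_support hDopen h4 _ l hl)
  · intro c hc
    simp only at hc
    obtain ⟨d, hd1, hd2⟩ := exists_between hc
    have hd0 : 0 < d := (mink_nonneg' _ _ _).trans_lt hd1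
    have h1 := mink_star hDopen hDconv hx hd1
    have hcont : ContinuousAt (fun q : (Fin n → ℝ) × (Fin n → ℝ) => q.1 + d⁻¹ • q.2) (x, y) := by
      fun_prop
    filter_upwards [hcont (hDopen.mem_nhds h1)] with q hq
    exact (mink_le' hd0 hq).trans_lt hd2


/-! ### the elliptic tube -/

lemma rePart_conjC (w : Fin n → ℂ) : rePart n (conjC n w) = rePart n w := by
  ext i; simp [rePart, conjC]

lemma imPart_conjC (w : Fin n → ℂ) : imPart n (conjC n w) = - imPart n w := by
  ext i; simp [imPart, conjC]

lemma conjC_conjC (w : Fin n → ℂ) : conjC n (conjC n w) = w := by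
  ext i; simp [conjC]

lemma rePart_reC (x : Fin n → ℝ) : rePart n (reC n x) = x := by
  ext i; simp [rePart, reC]

lemma imPart_reC (x : Fin n → ℝ) : imPart n (reC n x) = 0 := by
  ext i; simp [imPart, reC]

lemma rePart_line (x y : Fin n → ℝ) (g : ℂ) :
    rePart n (reC n x + g • reC n y) = x + g.re • y := by
  ext i; simp [rePart, reC]

lemma imPart_line (x y : Fin n → ℝ) (g : ℂ) :
    imPart n (reC n x + g • reC n y) = g.im • y := by
  ext i; simp [imPart, reC]

lemma continuous_rePart : Continuous (rePart n) := by
  unfold rePart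
  fun_prop

lemma continuous_imPart : Continuous (imPart n) := by
  unfold imPart
  fun_prop

/-- complexification of a real functional -/
noncomputable def ellC (l : (Fin n → ℝ) →L[ℝ] ℝ) : (Fin n → ℂ) →L[ℂ] ℂ :=
  ∑ i, ((l (Pi.single i 1) : ℝ) : ℂ) • (ContinuousLinearMap.proj i : (Fin n → ℂ) →L[ℂ] ℂ)

lemma clm_apply_sum (l : (Fin n → ℝ) →L[ℝ] ℝ) (x : Fin n → ℝ) :
    l x = ∑ i, l (Pi.single i 1) * x i := by
  conv_lhs => rw [pi_eq_sum_univ' x]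
  rw [map_sum]
  refine Finset.sum_congr rfl fun i _ => ?_
  rw [map_smul, smul_eq_mul, mul_comm]

lemma ellC_re (l : (Fin n → ℝ) →L[ℝ] ℝ) (w : Fin n → ℂ) : (ellC l w).re = l (rePart n w) := by
  rw [clm_apply_sum l]
  simp [ellC, rePart]

lemma ellC_im (l : (Fin n → ℝ) →L[ℝ] ℝ) (w : Fin n → ℂ) : (ellC l w).im = l (imPart n w) := by
  rw [clm_apply_sum l]
  simp [ellC, imPart]

lemma arg_eq_arctan' {w : ℂ} (hw : 0 < w.re) : w.arg = Real.arctan (w.im / w.re) := by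
  have h := (Complex.abs_arg_lt_pi_div_two_iff (z := w)).2 (Or.inl hw)
  rw [abs_lt] at h
  rw [← Complex.tan_arg, Real.arctan_tan h.1 h.2]

lemma neg_arg_support {D : Set (Fin n → ℝ)} {l : (Fin n → ℝ) →L[ℝ] ℝ} {c : ℝ}
    (hl : ∀ a ∈ D, l a < c) {w : Fin n → ℂ} (hw : rePart n w ∈ D) :
    -(arg ((c : ℂ) - ellC l w)) = Real.arctan (l (imPart n w) / (c - l (rePart n w))) := by
  have := hl _ hw
  rw [arg_eq_arctan' (by simp only [sub_re, ofReal_re, ellC_re]; linarith)]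
  simp only [sub_re, ofReal_re, ellC_re, sub_im, ofReal_im, ellC_im, zero_sub, neg_div,
    Real.arctan_neg, neg_neg]

lemma arg_support {D : Set (Fin n → ℝ)} {l : (Fin n → ℝ) →L[ℝ] ℝ} {c : ℝ}
    (hl : ∀ a ∈ D, l a < c) {w : Fin n → ℂ} (hw : rePart n w ∈ D) :
    arg ((c : ℂ) - ellC l w) = Real.arctan (l (-imPart n w) / (c - l (rePart n w))) := by
  rw [map_neg, neg_div, Real.arctan_neg, ← neg_arg_support hl hw, neg_neg]

lemma pair_le {D : Set (Fin n → ℝ)} (hDopen : IsOpen D)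
    {l m : (Fin n → ℝ) →L[ℝ] ℝ} {c d : ℝ}
    (hl : ∀ a ∈ D, l a < c) (hm : ∀ a ∈ D, m a < d) {w : Fin n → ℂ} (hw : rePart n w ∈ D) :
    (arg ((d : ℂ) - ellC m w) - arg ((c : ℂ) - ellC l w)) / 2 ≤ ellTubeU n D w := by
  rw [sub_eq_add_neg, neg_arg_support hl hw, arg_support hm hw, ellTubeU, minkP, minkP,
    rePart_conjC, imPart_conjC]
  have h1 := Real.arctan_strictMono.monotone (le_support hDopen hw (imPart n w) l hl)
  have h2 := Real.arctan_strictMono.monotone (le_support hDopen hw (-imPart n w) m hm)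
  linarith

lemma neg_pair_le {D : Set (Fin n → ℝ)} (hDopen : IsOpen D)
    {l m : (Fin n → ℝ) →L[ℝ] ℝ} {c d : ℝ}
    (hl : ∀ a ∈ D, l a < c) (hm : ∀ a ∈ D, m a < d) {w : Fin n → ℂ} (hw : rePart n w ∈ D) :
    (arg ((c : ℂ) - ellC l w) - arg ((d : ℂ) - ellC m w)) / 2 ≤ ellTubeU n D w :=
  pair_le hDopen hm hl hw

lemma exists_pair {D : Set (Fin n → ℝ)} (hDopen : IsOpen D) (hDconv : Convex ℝ D)
    (hDbdd : Bornology.IsBounded D) {x : Fin n → ℝ} (hx : x ∈ D) {y : Fin n → ℝ} (hy : y ≠ 0) :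
    ∃ (l m : (Fin n → ℝ) →L[ℝ] ℝ) (c d : ℝ), (∀ a ∈ D, l a < c) ∧ (∀ a ∈ D, m a < d) ∧
      l y / (c - l x) = mink n D x y ∧ m (-y) / (d - m x) = mink n D x (-y) := by
  obtain ⟨l, c, hl, h1⟩ := exists_support hDopen hDconv hDbdd hx hy
  obtain ⟨m, d, hm, h2⟩ := exists_support hDopen hDconv hDbdd hx (neg_ne_zero.2 hy)
  exact ⟨l, m, c, d, hl, hm, h1, h2⟩

lemma U_nonneg (D : Set (Fin n → ℝ)) (w : Fin n → ℂ) : 0 ≤ ellTubeU n D w := by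
  have h1 : 0 ≤ Real.arctan (minkP n D w) := Real.arctan_nonneg.2 (mink_nonneg' _ _ _)
  have h2 : 0 ≤ Real.arctan (minkP n D (conjC n w)) := Real.arctan_nonneg.2 (mink_nonneg' _ _ _)
  unfold ellTubeU
  linarith

lemma U_lt {D : Set (Fin n → ℝ)} {w : Fin n → ℂ} (hw : w ∈ ellTube n D) :
    ellTubeU n D w < Real.pi / 4 := by
  obtain ⟨-, h⟩ := hw
  unfold ellTubeU
  have h1 : 0 ≤ minkP n D w := mink_nonneg' _ _ _
  generalize minkP n D w = p at *
  generalize minkP n D (conjC n w) = q at *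
  rcases h1.eq_or_lt with h0 | h0
  · subst h0
    have := Real.arctan_lt_pi_div_two q
    simp only [Real.arctan_zero]
    linarith
  · have h2 : q < p⁻¹ := by
      rw [← one_div, lt_div_iff₀ h0]
      linarith
    have h3 := Real.arctan_strictMono h2
    rw [Real.arctan_inv_of_pos h0] at h3
    linarith

lemma U_continuousAt {D : Set (Fin n → ℝ)} (hDopen : IsOpen D) (hDconv : Convex ℝ D)
    (hDbdd : Bornology.IsBounded D) {w : Fin n → ℂ} (hw : rePart n w ∈ D) :
    ContinuousAt (ellTubeU n D) w := by
  have h1 : ContinuousAt (fun w => minkP n D w) w :=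
    ContinuousAt.comp (f := fun w => (rePart n w, imPart n w))
      (g := fun q : (Fin n → ℝ) × (Fin n → ℝ) => mink n D q.1 q.2)
      (mink_cont hDopen hDconv hDbdd hw _)
      (continuous_rePart.prodMk continuous_imPart).continuousAt
  have h2 : ContinuousAt (fun w => minkP n D (conjC n w)) w := by
    simp only [minkP, rePart_conjC, imPart_conjC]
    exact ContinuousAt.comp (f := fun w => (rePart n w, -imPart n w))
      (g := fun q : (Fin n → ℝ) × (Fin n → ℝ) => mink n D q.1 q.2)
      (mink_cont hDopen hDconv hDbdd hw _)
      (continuous_rePart.prodMk continuous_imPart.neg).continuousAt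
  have h3 := (Real.continuous_arctan.continuousAt.comp h1).add
    (Real.continuous_arctan.continuousAt.comp h2)
  exact h3.div_const 2

lemma arg_mean {A : ℂ → ℂ} (hA : Differentiable ℂ A) {c : ℂ} {r : ℝ} (hr : 0 < r)
    (h : ∀ ζ ∈ closedBall c r, 0 < (A ζ).re) :
    IntervalIntegrable (fun θ => arg (A (circleMap c r θ))) MeasureTheory.volume 0 (2 * Real.pi) ∧
    (2 * Real.pi)⁻¹ * ∫ θ in (0:ℝ)..(2 * Real.pi), arg (A (circleMap c r θ)) = arg (A c) := by
  have hd : ∀ ζ ∈ closedBall c r, DifferentiableAt ℂ (fun ζ => log (A ζ)) ζ := fun ζ hζ =>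
    (hA ζ).clog (Or.inl (h ζ hζ))
  have hmem : ∀ θ, circleMap c r θ ∈ closedBall c r := fun θ =>
    circleMap_mem_closedBall c hr.le θ
  have hcont : Continuous (fun θ => log (A (circleMap c r θ))) := by
    rw [continuous_iff_continuousAt]
    intro θ
    exact ContinuousAt.comp (f := fun θ => circleMap c r θ) (g := fun ζ => log (A ζ))
      (hd _ (hmem θ)).continuousAt (continuous_circleMap c r).continuousAt
  have hcont2 : Continuous (fun θ => arg (A (circleMap c r θ))) := by
    have := Complex.continuous_im.comp hcont
    simpa [Function.comp_def, Complex.log_im] using this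
  refine ⟨hcont2.intervalIntegrable _ _, ?_⟩
  have hm : Real.circleAverage (fun ζ => log (A ζ)) c r = log (A c) := by
    refine circleAverage_of_differentiable_on_off_countable Set.countable_empty ?_ ?_
    · rw [abs_of_pos hr]
      exact fun ζ hζ => (hd ζ hζ).continuousAt.continuousWithinAt
    · rw [abs_of_pos hr]
      exact fun ζ hζ => hd ζ (ball_subset_closedBall hζ.1)
  rw [Real.circleAverage] at hm
  have h2 := Complex.imCLM.intervalIntegral_comp_comm (hcont.intervalIntegrable (μ := MeasureTheory.volume) 0 (2 * Real.pi))
  simp only [Complex.imCLM_apply, Complex.log_im] at h2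
  rw [h2]
  have := congrArg Complex.im hm
  rw [Complex.log_im] at this
  rw [← this]
  simp


lemma U_mem {D : Set (Fin n → ℝ)} (hDopen : IsOpen D) (hDconv : Convex ℝ D)
    (hDbdd : Bornology.IsBounded D) : MemPSHU n (ellTube n D) (ellTubeU n D) := by
  refine ⟨⟨?_, ?_⟩, fun w hw => ⟨U_nonneg D w, U_lt hw⟩, ?_⟩
  · have : ContinuousOn (ellTubeU n D) (ellTube n D) := fun w hw =>
      (U_continuousAt hDopen hDconv hDbdd hw.1).continuousWithinAt
    exact this.upperSemicontinuousOn
  · intro a b c r hr h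
    by_cases hy : imPart n (a + c • b) = 0
    · have h0 : ellTubeU n D (a + c • b) = 0 := by
        have hm := (h c (mem_closedBall_self hr.le)).1
        simp [ellTubeU, minkP, rePart_conjC, imPart_conjC, hy, mink_zero' hm]
      rw [h0]
      refine mul_nonneg (by positivity) ?_
      exact intervalIntegral.integral_nonneg (by positivity) fun θ _ => U_nonneg D _
    · have hm := (h c (mem_closedBall_self hr.le)).1
      obtain ⟨l, m, d, e, hl, hm', h1, h2⟩ := exists_pair hDopen hDconv hDbdd hm hy
      have hval : ellTubeU n D (a + c • b) =
          (arg ((e : ℂ) - ellC m (a + c • b)) - arg ((d : ℂ) - ellC l (a + c • b))) / 2 := by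
        rw [sub_eq_add_neg, neg_arg_support hl hm, arg_support hm' hm, h1, h2, ellTubeU, minkP,
          minkP, rePart_conjC, imPart_conjC, add_comm]
      have hpos : ∀ (k : (Fin n → ℝ) →L[ℝ] ℝ) (f : ℝ), (∀ a ∈ D, k a < f) →
          ∀ ζ ∈ closedBall c r, 0 < ((f : ℂ) - ellC k (a + ζ • b)).re := by
        intro k f hk ζ hζ
        have := hk _ (h ζ hζ).1
        simp only [sub_re, ofReal_re, ellC_re]
        linarith
      have hdiff : ∀ (k : (Fin n → ℝ) →L[ℝ] ℝ) (f : ℝ),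
          Differentiable ℂ (fun ζ : ℂ => (f : ℂ) - ellC k (a + ζ • b)) := by
        intro k f
        fun_prop
      obtain ⟨i1, e1⟩ := arg_mean (hdiff m e) hr (hpos m e hm')
      obtain ⟨i2, e2⟩ := arg_mean (hdiff l d) hr (hpos l d hl)
      have hcont : Continuous (fun θ : ℝ => ellTubeU n D (a + circleMap c r θ • b)) := by
        rw [continuous_iff_continuousAt]
        intro θ
        have hf : Continuous (fun θ : ℝ => a + circleMap c r θ • b) := by
          have := continuous_circleMap c r
          fun_prop
        exact ContinuousAt.comp (f := fun θ : ℝ => a + circleMap c r θ • b)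
          (U_continuousAt hDopen hDconv hDbdd (h _ (circleMap_mem_closedBall c hr.le θ)).1)
          hf.continuousAt
      rw [hval, ← e1, ← e2]
      have hintg := intervalIntegral.integral_mono (μ := MeasureTheory.volume) (a := 0)
        (b := 2 * Real.pi) (by positivity) ((i1.sub i2).div_const 2)
        (hcont.intervalIntegrable _ _)
        (fun θ => pair_le hDopen hl hm' (h _ (circleMap_mem_closedBall c hr.le θ)).1)
      rw [intervalIntegral.integral_div, intervalIntegral.integral_sub i1 i2] at hintg
      calc _ = (2 * Real.pi)⁻¹ * _ := by rw [← mul_sub, mul_div_assoc]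
        _ ≤ _ := mul_le_mul_of_nonneg_left hintg (by positivity)
  · intro x hx
    have hx' := hx.1
    rw [rePart_reC] at hx'
    simp [ellTubeU, minkP, rePart_conjC, imPart_conjC, imPart_reC, rePart_reC, mink_zero' hx']

lemma H_nonneg {ζ : ℂ} (h : ζ ∈ closedBall (0:ℂ) 1) (hi : 0 ≤ ζ.im) :
    0 ≤ (arg (1 + ζ) - arg (1 - ζ)) / 2 := by
  have h1 : 0 ≤ arg (1 + ζ) := Complex.arg_nonneg_iff.2 (by simpa using hi)
  have h2 : arg (1 - ζ) ≤ 0 := by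
    rcases hi.eq_or_lt with h0 | h0
    · have : ζ.re ≤ 1 := by
        have := Complex.abs_re_le_norm ζ
        rw [mem_closedBall_zero_iff] at h
        exact (le_abs_self _).trans (this.trans h)
      have h3 : arg (1 - ζ) = 0 := by
        rw [Complex.arg_eq_zero_iff]
        simp [← h0, this]
      exact h3.le
    · have := Complex.arg_neg_iff (z := 1 - ζ)
      exact (this.2 (by simpa using h0)).le
  linarith

lemma H_arc {ζ : ℂ} (h : ‖ζ‖ = 1) (hi : 0 < ζ.im) :
    (arg (1 + ζ) - arg (1 - ζ)) / 2 = Real.pi / 4 := by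
  have h1 : ζ.re ^ 2 + ζ.im ^ 2 = 1 := by
    have := Complex.sq_norm ζ
    rw [h, Complex.normSq_apply] at this
    linarith
  have h2 : ζ.re < 1 := by nlinarith
  have h3 : -1 < ζ.re := by nlinarith
  rw [arg_eq_arctan' (w := 1 + ζ) (by simp; linarith),
    arg_eq_arctan' (w := 1 - ζ) (by simp; linarith)]
  simp only [add_re, one_re, add_im, one_im, sub_re, sub_im, zero_add, zero_sub, neg_div,
    Real.arctan_neg]
  have h4 : ζ.im / (1 - ζ.re) = (ζ.im / (1 + ζ.re))⁻¹ := by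
    have : 1 - ζ.re ≠ 0 := by linarith
    have : 1 + ζ.re ≠ 0 := by linarith
    field_simp
    linarith
  rw [h4, Real.arctan_inv_of_pos (div_pos hi (by linarith))]
  ring

lemma normSq_mean (c : ℂ) (r : ℝ) :
    (∫ θ in (0:ℝ)..(2 * Real.pi), ‖circleMap c r θ‖ ^ 2) = 2 * Real.pi * (‖c‖ ^ 2 + r ^ 2) := by
  have h1 : ∀ θ, ‖circleMap c r θ‖ ^ 2 =
      (‖c‖ ^ 2 + r ^ 2) + ((2 * r * c.re) * Real.cos θ + (2 * r * c.im) * Real.sin θ) := by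
    intro θ
    rw [Complex.sq_norm, Complex.sq_norm, Complex.normSq_apply, Complex.normSq_apply]
    simp only [circleMap, add_re, add_im, mul_re, mul_im, Complex.exp_ofReal_mul_I_re,
      Complex.exp_ofReal_mul_I_im, ofReal_re, ofReal_im]
    have := Real.sin_sq_add_cos_sq θ
    linear_combination (r ^ 2) * this
  simp_rw [h1]
  rw [intervalIntegral.integral_add (Continuous.intervalIntegrable (by fun_prop) _ _) (Continuous.intervalIntegrable (by fun_prop) _ _),
    intervalIntegral.integral_add (Continuous.intervalIntegrable (by fun_prop) _ _) (Continuous.intervalIntegrable (by fun_prop) _ _)]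
  simp
  ring

lemma half_disc_max {V : ℂ → ℝ} (husc : UpperSemicontinuousOn V (closedBall 0 1))
    (hV : ∀ ζ ∈ closedBall (0:ℂ) 1, V ζ < Real.pi / 4)
    (hreal : ∀ ζ ∈ closedBall (0:ℂ) 1, ζ.im = 0 → V ζ = 0)
    (hsub : ∀ c : ℂ, ∀ r : ℝ, 0 < r → closedBall c r ⊆ closedBall 0 1 →
      V c ≤ (2 * Real.pi)⁻¹ * ∫ θ in (0:ℝ)..(2 * Real.pi), V (circleMap c r θ))
    {ζ : ℂ} (hζ : ζ ∈ closedBall (0:ℂ) 1) (hi : 0 ≤ ζ.im) :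
    V ζ ≤ (arg (1 + ζ) - arg (1 - ζ)) / 2 := by
  set H : ℂ → ℝ := fun ζ => (arg (1 + ζ) - arg (1 - ζ)) / 2 with hH
  set K : Set ℂ := closedBall 0 1 ∩ {ζ | 0 ≤ ζ.im} with hK
  have hKc : IsCompact K :=
    (isCompact_closedBall 0 1).inter_right (isClosed_le continuous_const Complex.continuous_im)
  suffices hmain : ∀ ε : ℝ, 0 < ε → ∀ ζ ∈ K, V ζ - H ζ + ε * ‖ζ‖ ^ 2 ≤ ε by
    refine le_of_forall_pos_le_add fun ε hε => ?_
    have h1 := hmain ε hε ζ ⟨hζ, hi⟩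
    have h2 : 0 ≤ ε * ‖ζ‖ ^ 2 := by positivity
    change V ζ ≤ H ζ + ε
    linarith
  intro ε hε
  have hHK : ∀ ζ ∈ K, 0 ≤ H ζ := fun ζ hζ => H_nonneg hζ.1 hζ.2
  have hnK : ∀ ζ ∈ K, ε * ‖ζ‖ ^ 2 ≤ ε := by
    intro ζ hζ
    have h1 := mem_closedBall_zero_iff.1 hζ.1
    have h2 : ‖ζ‖ ^ 2 ≤ 1 := pow_le_one₀ (norm_nonneg _) h1
    nlinarith
  -- upper semicontinuity
  have husc1 : ∀ ζ₀ ∈ K, UpperSemicontinuousWithinAt (fun ζ => V ζ + ε * ‖ζ‖ ^ 2) K ζ₀ := by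
    intro ζ₀ h0
    have hc : Continuous (fun ζ : ℂ => ε * ‖ζ‖ ^ 2) := by fun_prop
    have h1 : UpperSemicontinuousWithinAt V K ζ₀ := (husc ζ₀ h0.1).mono inter_subset_left
    exact UpperSemicontinuousWithinAt.add h1
      (hc.upperSemicontinuous.upperSemicontinuousWithinAt _ _)
  have husc2 : UpperSemicontinuousOn (fun ζ => V ζ - H ζ + ε * ‖ζ‖ ^ 2) K := by
    intro ζ₀ h0
    by_cases hH0 : ζ₀ = 1 ∨ ζ₀ = -1
    · have hz : H ζ₀ = 0 := by
        rcases hH0 with rfl | rfl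
        · have : arg ((1 : ℂ) + 1) = 0 := by
            rw [Complex.arg_eq_zero_iff]; norm_num
          simp [hH, this]
        · have : arg ((1 : ℂ) + 1) = 0 := by
            rw [Complex.arg_eq_zero_iff]; norm_num
          simp [hH, this]
      intro y hy
      have := husc1 ζ₀ h0 y (by simp only [hz, sub_zero] at hy; exact hy)
      filter_upwards [this, self_mem_nhdsWithin] with ζ h1 h2
      have := hHK ζ h2
      linarith
    · have hre : -1 < ζ₀.re ∧ ζ₀.re < 1 := by
        push Not at hH0
        have h1 := mem_closedBall_zero_iff.1 h0.1
        have h2 : ζ₀.re ^ 2 + ζ₀.im ^ 2 ≤ 1 := by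
          have := Complex.sq_norm ζ₀
          rw [Complex.normSq_apply] at this
          have h3 : ‖ζ₀‖ ^ 2 ≤ 1 := pow_le_one₀ (norm_nonneg _) h1
          nlinarith
        have h4 : -1 ≤ ζ₀.re ∧ ζ₀.re ≤ 1 := by constructor <;> nlinarith [sq_nonneg ζ₀.im]
        constructor
        · refine lt_of_le_of_ne h4.1 fun he => hH0.2 ?_
          rw [← he] at h2
          have : ζ₀.im = 0 := by nlinarith
          apply Complex.ext <;> simp [← he, this]
        · refine lt_of_le_of_ne h4.2 fun he => hH0.1 ?_
          rw [he] at h2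
          have : ζ₀.im = 0 := by nlinarith
          apply Complex.ext <;> simp [he, this]
      have hc1 : ContinuousAt (fun ζ : ℂ => arg (1 + ζ)) ζ₀ :=
        ContinuousAt.comp (f := fun ζ : ℂ => 1 + ζ) (g := arg)
          (Complex.continuousAt_arg (Or.inl (by simp; linarith))) (by fun_prop)
      have hc2 : ContinuousAt (fun ζ : ℂ => arg (1 - ζ)) ζ₀ :=
        ContinuousAt.comp (f := fun ζ : ℂ => 1 - ζ) (g := arg)
          (Complex.continuousAt_arg (Or.inl (by simp; linarith))) (by fun_prop)
      have hc3 : ContinuousAt (fun ζ => - H ζ) ζ₀ := ((hc1.sub hc2).div_const 2).neg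
      have := UpperSemicontinuousWithinAt.add (husc1 ζ₀ h0)
        (hc3.continuousWithinAt (s := K)).upperSemicontinuousWithinAt
      have he : (fun ζ => V ζ - H ζ + ε * ‖ζ‖ ^ 2) = fun z => V z + ε * ‖z‖ ^ 2 + -H z := by
        funext z; ring
      rw [he]
      exact this
  obtain ⟨m, hmK, hmax⟩ := UpperSemicontinuousOn.exists_isMaxOn (s := K) ⟨ζ, hζ, hi⟩ hKc husc2
  have hmax' : ∀ ζ ∈ K, V ζ - H ζ + ε * ‖ζ‖ ^ 2 ≤ V m - H m + ε * ‖m‖ ^ 2 := fun ζ hζ => hmax hζ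
  suffices hm : V m - H m + ε * ‖m‖ ^ 2 ≤ ε from fun ζ hζ => (hmax' ζ hζ).trans hm
  have hHm := hHK m hmK
  have hnm := hnK m hmK
  by_cases him : m.im = 0
  · have := hreal m hmK.1 him
    linarith
  have him' : 0 < m.im := lt_of_le_of_ne hmK.2 (Ne.symm him)
  by_cases hnorm : ‖m‖ = 1
  · have h1 : H m = Real.pi / 4 := H_arc hnorm him'
    have := hV m hmK.1
    linarith
  have hnorm' : ‖m‖ < 1 := lt_of_le_of_ne (mem_closedBall_zero_iff.1 hmK.1) hnorm
  set r : ℝ := min m.im (1 - ‖m‖) / 2 with hr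
  have hmin : 0 < min m.im (1 - ‖m‖) := lt_min him' (by linarith)
  have hr0 : 0 < r := by positivity
  have hr1 : r < m.im := by have := min_le_left m.im (1 - ‖m‖); linarith
  have hr2 : r < 1 - ‖m‖ := by have := min_le_right m.im (1 - ‖m‖); linarith
  have hball : ∀ ξ ∈ closedBall m r, ‖ξ‖ < 1 ∧ 0 < ξ.im := by
    intro ξ hξ
    rw [mem_closedBall, dist_eq_norm] at hξ
    constructor
    · have := norm_add_le (ξ - m) m
      rw [sub_add_cancel] at this
      linarith
    · have := (abs_le.1 ((Complex.abs_im_le_norm (ξ - m)).trans hξ)).1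
      rw [sub_im] at this
      linarith
  have hballK : ∀ ξ ∈ closedBall m r, ξ ∈ K := fun ξ hξ =>
    ⟨mem_closedBall_zero_iff.2 (hball ξ hξ).1.le, (hball ξ hξ).2.le⟩
  have hs := hsub m r hr0 fun ξ hξ => (hballK ξ hξ).1
  by_cases hintg : IntervalIntegrable (fun θ => V (circleMap m r θ)) MeasureTheory.volume 0
      (2 * Real.pi)
  swap
  · rw [intervalIntegral.integral_undef hintg, mul_zero] at hs
    linarith
  exfalso
  have hre : ∀ ξ ∈ closedBall m r, -1 < ξ.re ∧ ξ.re < 1 := fun ξ hξ =>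
    abs_lt.1 ((Complex.abs_re_le_norm ξ).trans_lt (hball ξ hξ).1)
  obtain ⟨i1, e1⟩ := arg_mean (A := fun ζ => 1 + ζ) (by fun_prop) hr0
    (fun ξ hξ => by have := hre ξ hξ; simp; linarith)
  obtain ⟨i2, e2⟩ := arg_mean (A := fun ζ => 1 - ζ) (by fun_prop) hr0
    (fun ξ hξ => by have := hre ξ hξ; simp; linarith)
  have hnint : IntervalIntegrable (fun θ => ε * ‖circleMap m r θ‖ ^ 2) MeasureTheory.volume 0
      (2 * Real.pi) := by
    have := continuous_circleMap m r
    exact Continuous.intervalIntegrable (by fun_prop) _ _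
  set M := V m - H m + ε * ‖m‖ ^ 2 with hM
  have hcint : IntervalIntegrable (fun _ : ℝ => M) MeasureTheory.volume 0 (2 * Real.pi) := by simp
  have hmono := intervalIntegral.integral_mono (μ := MeasureTheory.volume) (a := 0)
    (b := 2 * Real.pi) (by positivity) hintg
    ((hcint.add ((i1.sub i2).div_const 2)).sub hnint) (fun θ => by
      have := hmax' _ (hballK _ (circleMap_mem_closedBall m hr0.le θ))
      simp only [hH] at this ⊢
      linarith)
  rw [intervalIntegral.integral_sub (hcint.add ((i1.sub i2).div_const 2)) hnint,
    intervalIntegral.integral_add hcint ((i1.sub i2).div_const 2),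
    intervalIntegral.integral_div, intervalIntegral.integral_sub i1 i2,
    intervalIntegral.integral_const_mul, normSq_mean, intervalIntegral.integral_const] at hmono
  have hpi : 0 < 2 * Real.pi := by positivity
  have hmono2 := mul_le_mul_of_nonneg_left hmono (inv_pos.2 hpi).le
  have key : (2 * Real.pi)⁻¹ * ((2 * Real.pi - 0) • M + ((∫ θ in (0:ℝ)..(2 * Real.pi), arg (1 + circleMap m r θ)) - ∫ θ in (0:ℝ)..(2 * Real.pi), arg (1 - circleMap m r θ)) / 2 - ε * (2 * Real.pi * (‖m‖ ^ 2 + r ^ 2))) = M + H m - ε * (‖m‖ ^ 2 + r ^ 2) := by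
    simp only [hH]
    rw [← e1, ← e2, smul_eq_mul]
    field_simp
    ring
  rw [key] at hmono2
  have : 0 < ε * r ^ 2 := by positivity
  linarith


lemma tube_mem {D : Set (Fin n → ℝ)} (hDconv : Convex ℝ D) {x y : Fin n → ℝ} {α β : ℝ}
    (h1 : x + β • y ∈ D) (h2 : x - α • y ∈ D) {g : ℂ}
    (hg1 : -α < g.re) (hg2 : g.re < β) (hg : g.im ^ 2 < (β - g.re) * (g.re + α)) :
    reC n x + g • reC n y ∈ ellTube n D := by
  have hs : 0 < α + β := by linarith
  have hD : x + g.re • y ∈ D := by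
    have := hDconv h1 h2 (a := (g.re + α) / (α + β)) (b := (β - g.re) / (α + β))
      (div_nonneg (by linarith) hs.le) (div_nonneg (by linarith) hs.le)
      (by field_simp; ring)
    convert this using 1
    ext i
    simp
    field_simp
    ring
  refine ⟨by rw [rePart_line]; exact hD, ?_⟩
  rw [minkP, minkP, rePart_conjC, imPart_conjC, rePart_line, imPart_line]
  have a1 : 0 < β - g.re := by linarith
  have a2 : 0 < g.re + α := by linarith
  -- general bound
  have key : ∀ τ : ℝ, 0 < τ → τ ^ 2 < (β - g.re) * (g.re + α) →
      mink n D (x + g.re • y) (τ • y) * mink n D (x + g.re • y) (-(τ • y)) < 1 := by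
    intro τ hτ hlt
    have b1 : mink n D (x + g.re • y) (τ • y) ≤ τ / (β - g.re) := by
      refine mink_le' (by positivity) ?_
      convert h1 using 1
      ext i
      simp
      field_simp
      ring
    have b2 : mink n D (x + g.re • y) (-(τ • y)) ≤ τ / (g.re + α) := by
      refine mink_le' (by positivity) ?_
      convert h2 using 1
      ext i
      simp
      field_simp
      ring
    calc _ ≤ τ / (β - g.re) * (τ / (g.re + α)) :=
          mul_le_mul b1 b2 (mink_nonneg' _ _ _) (by positivity)
      _ < 1 := by
          rw [div_mul_div_comm, div_lt_one (by positivity)]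
          nlinarith
  rcases lt_trichotomy g.im 0 with h | h | h
  · have := key (-g.im) (by linarith) (by rw [neg_sq]; exact hg)
    rw [neg_smul, neg_neg, mul_comm] at this
    exact this
  · rw [h, zero_smul, mink_zero' hD]
    simp
  · exact key _ h hg

lemma tube_mem_closed {D : Set (Fin n → ℝ)} (hDopen : IsOpen D) (hDconv : Convex ℝ D)
    {x y : Fin n → ℝ} {α β : ℝ} (h1 : x + β • y ∈ D) (h2 : x - α • y ∈ D) {g : ℂ}
    (hg1 : -α ≤ g.re) (hg2 : g.re ≤ β) (hg : g.im ^ 2 ≤ (β - g.re) * (g.re + α)) :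
    reC n x + g • reC n y ∈ ellTube n D := by
  have c1 : ContinuousAt (fun t : ℝ => x + t • y) β := by fun_prop
  have c2 : ContinuousAt (fun t : ℝ => x - t • y) α := by fun_prop
  have e1 : ∀ᶠ t in nhdsWithin β (Set.Ioi β), x + t • y ∈ D :=
    nhdsWithin_le_nhds (c1 (hDopen.mem_nhds h1))
  have e2 : ∀ᶠ t in nhdsWithin α (Set.Ioi α), x - t • y ∈ D :=
    nhdsWithin_le_nhds (c2 (hDopen.mem_nhds h2))
  obtain ⟨b, hb1, hb2⟩ := (e1.and self_mem_nhdsWithin).exists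
  obtain ⟨a, ha1, ha2⟩ := (e2.and self_mem_nhdsWithin).exists
  have hb2 : β < b := hb2
  have ha2 : α < a := ha2
  refine tube_mem hDconv hb1 ha1 (by linarith) (by linarith) (hg.trans_lt ?_)
  nlinarith [mul_pos (sub_pos.2 hb2) (sub_pos.2 ha2), mul_nonneg (sub_nonneg.2 hg2) (sub_pos.2 ha2).le, mul_nonneg (show 0 ≤ g.re + α by linarith) (sub_pos.2 hb2).le]

lemma arctan_le_self' {s : ℝ} (hs : 0 ≤ s) : Real.arctan s ≤ s := by
  have := Real.le_tan (Real.arctan_nonneg.2 hs) (Real.arctan_lt_pi_div_two s)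
  rwa [Real.tan_arctan] at this

lemma v_bound {D : Set (Fin n → ℝ)} (hDopen : IsOpen D) (hDconv : Convex ℝ D)
    {v : (Fin n → ℂ) → ℝ} (hv : MemPSHU n (ellTube n D) v)
    {x y : Fin n → ℝ} {α β : ℝ} (hα : 0 < α) (hβ : 0 < β)
    (h1 : x + β • y ∈ D) (h2 : x - α • y ∈ D) {t : ℝ} (ht : 0 ≤ t) (ht2 : t ^ 2 ≤ α * β) :
    v (reC n x + (I * t) • reC n y) ≤ t * ((α⁻¹ + β⁻¹) / 2) := by
  obtain ⟨c, hc⟩ : ∃ c : ℝ, c = (β - α) / 2 := ⟨_, rfl⟩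
  obtain ⟨R, hR⟩ : ∃ R : ℝ, R = (α + β) / 2 := ⟨_, rfl⟩
  have hR0 : 0 < R := by rw [hR]; positivity
  have hRc : R - c = α := by rw [hR, hc]; ring
  have hRc' : R + c = β := by rw [hR, hc]; ring
  set a : Fin n → ℂ := reC n x + (c : ℂ) • reC n y with ha
  set b : Fin n → ℂ := (R : ℂ) • reC n y with hb
  have hab : ∀ ζ : ℂ, a + ζ • b = reC n x + ((c : ℂ) + R * ζ) • reC n y := by
    intro ζ
    rw [ha, hb, smul_smul, add_assoc, ← add_smul, mul_comm ζ]
  have hmem : ∀ ζ ∈ closedBall (0:ℂ) 1, a + ζ • b ∈ ellTube n D := by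
    intro ζ hζ
    rw [mem_closedBall_zero_iff] at hζ
    rw [hab]
    have hn : ζ.re ^ 2 + ζ.im ^ 2 ≤ 1 := by
      have := Complex.sq_norm ζ
      rw [Complex.normSq_apply] at this
      have h3 : ‖ζ‖ ^ 2 ≤ 1 := pow_le_one₀ (norm_nonneg _) hζ
      nlinarith
    have hre := abs_le.1 ((Complex.abs_re_le_norm ζ).trans hζ)
    refine tube_mem_closed hDopen hDconv h1 h2 ?_ ?_ ?_
    · simp
      nlinarith
    · simp
      nlinarith
    · simp
      rw [← hRc, ← hRc']
      nlinarith [mul_nonneg (sq_nonneg R) (sub_nonneg.2 hn)]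
  obtain ⟨⟨husc, hsub⟩, hbd, hre0⟩ := hv
  have hcont : Continuous (fun ζ : ℂ => a + ζ • b) := by fun_prop
  have hmain := half_disc_max (V := fun ζ => v (a + ζ • b))
    (UpperSemicontinuousOn.comp (g := fun ζ : ℂ => a + ζ • b) husc hcont.continuousOn hmem)
    (fun ζ hζ => (hbd _ (hmem ζ hζ)).2)
    (fun ζ hζ h0 => by
      have he : a + ζ • b = reC n (x + (c + R * ζ.re) • y) := by
        rw [hab]
        ext i
        have : ζ = (ζ.re : ℂ) := by apply Complex.ext <;> simp [h0]
        rw [this]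
        simp [reC]
      have := hmem ζ hζ
      rw [he] at this ⊢
      exact hre0 _ this)
    (fun d r hr hsubset => hsub a b d r hr fun ζ hζ => hmem ζ (hsubset hζ))
    (ζ := ((-c / R : ℝ) : ℂ) + ((t / R : ℝ) : ℂ) * I)
    (by
      rw [mem_closedBall_zero_iff, ← sq_le_one_iff₀ (norm_nonneg _), Complex.sq_norm,
        Complex.normSq_add_mul_I, div_pow, div_pow, ← add_div, div_le_one (by positivity)]
      nlinarith)
    (by
      simp only [add_im, ofReal_im, mul_im, I_re, I_im, ofReal_re, mul_one, mul_zero, add_zero, zero_add]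
      positivity)
  have hpt : a + (((-c / R : ℝ) : ℂ) + ((t / R : ℝ) : ℂ) * I) • b =
      reC n x + (I * t) • reC n y := by
    rw [hab]
    congr 2
    have : (R : ℂ) ≠ 0 := by exact_mod_cast hR0.ne'
    push_cast
    field_simp
    ring
  simp only [hpt] at hmain
  refine hmain.trans ?_
  have hp1 : 0 < 1 + -c / R := by
    rw [show 1 + -c / R = α / R by rw [← hRc]; field_simp; ring]; positivity
  have hp2 : 0 < 1 - -c / R := by
    rw [show 1 - -c / R = β / R by rw [← hRc']; field_simp; ring]; positivity
  rw [arg_eq_arctan' (by simpa using hp1), arg_eq_arctan' (by simpa using hp2)]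
  simp only [add_im, one_im, ofReal_im, mul_im, I_re, I_im, ofReal_re, mul_one, mul_zero, add_zero,
    zero_add, add_re, one_re, mul_re, sub_zero, sub_re, sub_im, zero_sub, ]
  have q1 : t / R / (1 + -c / R) = t * α⁻¹ := by
    rw [show 1 + -c / R = α / R by rw [← hRc]; field_simp; ring]
    field_simp
  have q2 : -(t / R) / (1 - -c / R) = - (t * β⁻¹) := by
    rw [show 1 - -c / R = β / R by rw [← hRc']; field_simp; ring]
    field_simp
  rw [q1, q2, Real.arctan_neg, sub_neg_eq_add]
  have w1 := arctan_le_self' (show 0 ≤ t * α⁻¹ by positivity)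
  have w2 := arctan_le_self' (show 0 ≤ t * β⁻¹ by positivity)
  linarith


lemma EInf_le {D : Set (Fin n → ℝ)} (hDopen : IsOpen D) (hDconv : Convex ℝ D)
    {v : (Fin n → ℂ) → ℝ} (hv : MemPSHU n (ellTube n D) v)
    {x y : Fin n → ℝ} {α β : ℝ} (hα : 0 < α) (hβ : 0 < β)
    (h1 : x + β • y ∈ D) (h2 : x - α • y ∈ D) :
    EInf n (ellTube n D) v x y ≤ (((α⁻¹ + β⁻¹) / 2 : ℝ) : EReal) := by
  have he : 0 < min α β := lt_min hα hβ
  have hsq : ∀ t ∈ Set.Ioo (-(min α β)) (min α β), t ^ 2 < α * β := by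
    intro t ht
    have h3 : |t| < min α β := abs_lt.2 ht
    have h4 : |t| < α := h3.trans_le (min_le_left _ _)
    have h5 : |t| < β := h3.trans_le (min_le_right _ _)
    rw [← sq_abs, sq]
    exact mul_lt_mul'' h4 h5 (abs_nonneg _) (abs_nonneg _)
  refine sInf_le_of_le ⟨min α β, he, fun t : ℝ => reC n x + (I * (t : ℂ)) • reC n y, ?_, ?_, ?_, ?_, rfl⟩ ?_
  · have : ContDiff ℝ 1 (fun t : ℝ => reC n x + (I * (t : ℂ)) • reC n y) := by
      have hof : ContDiff ℝ 1 (fun t : ℝ => (t : ℂ)) := Complex.ofRealCLM.contDiff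
      exact contDiff_const.add ((contDiff_const.mul hof).smul contDiff_const)
    exact this.contDiffOn
  · intro t ht
    refine tube_mem hDconv h1 h2 (by simpa using hα) (by simpa using hβ) ?_
    have := hsq t ht
    simp
    linarith
  · simp
  · have hof : HasDerivAt (fun t : ℝ => (t : ℂ)) 1 0 := Complex.ofRealCLM.hasDerivAt
    have := ((hof.const_mul I).smul_const (reC n y)).const_add (reC n x)
    simpa using this
  · refine limsup_le_of_le (by isBoundedDefault) ?_
    have hmem : Set.Ioo (0:ℝ) (min α β) ∈ nhdsWithin (0:ℝ) (Set.Ioi 0) := Ioo_mem_nhdsGT he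
    filter_upwards [hmem] with t ht
    rw [EReal.coe_le_coe_iff, div_le_iff₀ ht.1]
    have := v_bound hDopen hDconv hv hα hβ h1 h2 ht.1.le
      (hsq t ⟨by linarith [ht.1], ht.2⟩).le
    linarith

lemma FInf_le {D : Set (Fin n → ℝ)} (hDconv : Convex ℝ D)
    {x y : Fin n → ℝ} {s t : ℝ} (hs : 0 < s) (ht : 0 < t)
    (h1 : x + s⁻¹ • y ∈ D) (h2 : x - t⁻¹ • y ∈ D) :
    FInf n D (ellTube n D) x y ≤ (((s + t) / 2 : ℝ) : EReal) := by
  obtain ⟨A, hA⟩ : ∃ A : ℝ, A = (s + t) / 2 := ⟨_, rfl⟩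
  obtain ⟨B, hB⟩ : ∃ B : ℝ, B = (s - t) / 2 := ⟨_, rfl⟩
  have hA0 : 0 < A := by rw [hA]; positivity
  have hs' : s = A + B := by rw [hA, hB]; ring
  have ht' : t = A - B := by rw [hA, hB]; ring
  have hden : ∀ ζ ∈ ball (0:ℂ) 1, (A : ℂ) + B * ζ ≠ 0 := by
    intro ζ hζ h0
    rw [mem_ball_zero_iff] at hζ
    have h3 := abs_lt.1 ((Complex.abs_re_le_norm ζ).trans_lt hζ)
    have h4 := congrArg Complex.re h0
    simp at h4
    nlinarith
  have hmem : ∀ ζ ∈ ball (0:ℂ) 1,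
      reC n x + (ζ / ((A : ℂ) + B * ζ)) • reC n y ∈ ellTube n D := by
    intro ζ hζ
    have hd := hden ζ hζ
    obtain ⟨g, hg⟩ : ∃ g : ℂ, g = ζ / ((A : ℂ) + B * ζ) := ⟨_, rfl⟩
    rw [← hg]
    have hz : (A : ℂ) * g = ζ * (1 - B * g) := by
      have hgd : g * ((A : ℂ) + B * ζ) = ζ := by rw [hg]; exact div_mul_cancel₀ _ hd
      linear_combination hgd
    rw [mem_ball_zero_iff] at hζ
    have hz2 := congrArg (fun w : ℂ => ‖w‖ ^ 2) hz
    simp only [norm_mul, mul_pow] at hz2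
    have hne : 0 < ‖1 - (B : ℂ) * g‖ ^ 2 := by
      have : 1 - (B : ℂ) * g ≠ 0 := by
        intro h0
        rw [h0, mul_zero] at hz
        have hA' : (A : ℂ) ≠ 0 := by exact_mod_cast hA0.ne'
        have hg0 : g = 0 := by simpa [hA'] using hz
        rw [hg0] at h0
        simp at h0
      positivity
    have hlt : ‖ζ‖ ^ 2 < 1 := by
      rw [sq_lt_one_iff₀ (norm_nonneg _)]; exact hζ
    have hineq : ‖(A : ℂ)‖ ^ 2 * ‖g‖ ^ 2 < ‖1 - (B : ℂ) * g‖ ^ 2 := by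
      rw [hz2]; nlinarith
    rw [Complex.sq_norm, Complex.sq_norm, Complex.sq_norm, Complex.normSq_apply,
      Complex.normSq_apply, Complex.normSq_apply] at hineq
    simp at hineq
    have hst : s * t * (g.re ^ 2 + g.im ^ 2) + (s - t) * g.re < 1 := by
      rw [hs', ht']
      nlinarith
    have hprod : s * t * g.im ^ 2 < (1 - s * g.re) * (1 + t * g.re) := by nlinarith
    have hpp : 0 < (1 - s * g.re) * (1 + t * g.re) :=
      lt_of_le_of_lt (by positivity) hprod
    have hb : 0 < 1 - s * g.re ∧ 0 < 1 + t * g.re := by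
      rcases mul_pos_iff.1 hpp with h | h
      · exact h
      · exfalso
        have a1 : 0 < g.re := by
          by_contra hc
          have := mul_nonneg hs.le (neg_nonneg.2 (not_lt.1 hc))
          linarith
        have := mul_pos ht a1
        linarith
    refine tube_mem hDconv h1 h2 ?_ ?_ ?_
    · rw [neg_lt_iff_pos_add]
      have : g.re + t⁻¹ = (1 + t * g.re) / t := by field_simp; ring
      rw [this]
      exact div_pos hb.2 ht
    · rw [← sub_pos]
      have : s⁻¹ - g.re = (1 - s * g.re) / s := by field_simp
      rw [this]
      exact div_pos hb.1 hs
    · have : (s⁻¹ - g.re) * (g.re + t⁻¹) = (1 - s * g.re) * (1 + t * g.re) / (s * t) := by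
        field_simp; ring
      rw [this, lt_div_iff₀ (by positivity)]
      linarith
  refine sInf_le ⟨(s + t) / 2, by positivity, rfl,
    fun ζ => reC n x + (ζ / ((A : ℂ) + B * ζ)) • reC n y, ?_, hmem, ?_, ?_, ?_⟩
  · intro ζ hζ
    have := hden ζ hζ
    refine DifferentiableAt.differentiableWithinAt ?_
    refine DifferentiableAt.const_add _ (DifferentiableAt.smul_const ?_ _)
    exact DifferentiableAt.div (by fun_prop) (by fun_prop) this
  · intro r hr
    have hrb : (r : ℂ) ∈ ball (0:ℂ) 1 := by
      rw [mem_ball_zero_iff, Complex.norm_real]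
      exact abs_lt.2 hr
    have hm := (hmem _ hrb).1
    have he : reC n x + ((r : ℂ) / ((A : ℂ) + B * r)) • reC n y =
        reC n (x + (r / (A + B * r)) • y) := by
      ext i; simp [reC]
    simp only
    rw [he] at hm ⊢
    rw [rePart_reC] at hm
    exact ⟨_, hm, rfl⟩
  · simp
  · have hd0 := hden 0 (by simp)
    have hden' : HasDerivAt (fun ζ : ℂ => (A : ℂ) + B * ζ) (B : ℂ) 0 := by
      simpa using ((hasDerivAt_id (0:ℂ)).const_mul (B : ℂ)).const_add (A : ℂ)
    have h3 := (((hasDerivAt_id (0:ℂ)).div hden' hd0).smul_const (reC n y)).const_add (reC n x)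
    have hA' : (A : ℂ) ≠ 0 := by exact_mod_cast hA0.ne'
    have hv : (((1:ℂ) * ((A:ℂ) + B * 0) - id 0 * B) / ((A:ℂ) + B * 0) ^ 2) • reC n y =
        ((s + t) / 2)⁻¹ • reC n y := by
      have hc : ((1:ℂ) * ((A:ℂ) + B * 0) - id 0 * B) / ((A:ℂ) + B * 0) ^ 2 = ((A⁻¹ : ℝ) : ℂ) := by
        push_cast
        simp only [id, mul_zero, add_zero, zero_mul, sub_zero, one_mul]
        field_simp
      rw [hc, ← hA]
      ext i
      simp
    rw [hv] at h3
    exact h3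

lemma mink_smul_le {D : Set (Fin n → ℝ)} (hDopen : IsOpen D) (hDconv : Convex ℝ D)
    {x : Fin n → ℝ} (hx : x ∈ D) (y : Fin n → ℝ) {t : ℝ} (ht : 0 < t) :
    mink n D x (t • y) ≤ t * mink n D x y := by
  rw [← div_le_iff₀' ht]
  refine le_of_forall_gt_imp_ge_of_dense fun s hs => ?_
  have hs0 : 0 < s := (mink_nonneg' _ _ _).trans_lt hs
  rw [div_le_iff₀' ht]
  refine mink_le' (by positivity) ?_
  have := mink_star hDopen hDconv hx hs
  rwa [smul_smul, show (t * s)⁻¹ * t = s⁻¹ by field_simp]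

lemma mink_smul' {D : Set (Fin n → ℝ)} (hDopen : IsOpen D) (hDconv : Convex ℝ D)
    {x : Fin n → ℝ} (hx : x ∈ D) (y : Fin n → ℝ) {t : ℝ} (ht : 0 < t) :
    mink n D x (t • y) = t * mink n D x y := by
  refine le_antisymm (mink_smul_le hDopen hDconv hx y ht) ?_
  have := mink_smul_le hDopen hDconv hx (t • y) (inv_pos.2 ht)
  rw [smul_smul, inv_mul_cancel₀ ht.ne', one_smul] at this
  rwa [le_inv_mul_iff₀ ht] at this

lemma arctan_scaled {P : ℝ → ℝ} {p : ℝ} (hP : Tendsto P (nhdsWithin 0 (Set.Ioi 0)) (nhds p)) :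
    Tendsto (fun t => Real.arctan (t * P t) / t) (nhdsWithin 0 (Set.Ioi 0)) (nhds p) := by
  have hd : ContinuousAt (dslope Real.arctan 0) 0 :=
    continuousAt_dslope_same.2 Real.differentiable_arctan.differentiableAt
  have h0 : Tendsto (fun t : ℝ => t) (nhdsWithin 0 (Set.Ioi 0)) (nhds 0) := nhdsWithin_le_nhds
  have h1 : Tendsto (fun t => t * P t) (nhdsWithin 0 (Set.Ioi 0)) (nhds 0) := by
    simpa using h0.mul hP
  have h2 := hP.mul (hd.tendsto.comp h1)
  have h3 : dslope Real.arctan 0 0 = 1 := by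
    rw [dslope_same, Real.deriv_arctan]; norm_num
  rw [h3, mul_one] at h2
  refine h2.congr' ?_
  filter_upwards [self_mem_nhdsWithin] with t ht
  have ht : 0 < t := ht
  have h4 := sub_smul_dslope Real.arctan 0 (t * P t)
  simp only [sub_zero, Real.arctan_zero, smul_eq_mul] at h4
  rw [← h4]
  simp only [Function.comp]
  field_simp

lemma U_curve {D : Set (Fin n → ℝ)} (hDopen : IsOpen D) (hDconv : Convex ℝ D)
    (hDbdd : Bornology.IsBounded D) {x : Fin n → ℝ} (hx : x ∈ D) (y : Fin n → ℝ)
    {γ : ℝ → Fin n → ℂ} (h0 : γ 0 = reC n x) (hγ : HasDerivAt γ (I • reC n y) 0) :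
    Tendsto (fun t => ellTubeU n D (γ t) / t) (nhdsWithin 0 (Set.Ioi 0))
      (nhds ((mink n D x y + mink n D x (-y)) / 2)) := by
  have hre : Tendsto (fun t => rePart n (γ t)) (nhdsWithin 0 (Set.Ioi 0)) (nhds x) := by
    have h1 := (continuous_rePart.continuousAt.comp hγ.continuousAt).tendsto
    simp only [Function.comp, h0, rePart_reC] at h1
    exact h1.mono_left nhdsWithin_le_nhds
  have him : Tendsto (fun t => t⁻¹ • imPart n (γ t)) (nhdsWithin 0 (Set.Ioi 0)) (nhds y) := by
    have h1 := hγ.tendsto_slope_zero_right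
    have h2 := (continuous_imPart.tendsto _).comp h1
    have h3 : imPart n (I • reC n y) = y := by ext i; simp [imPart, reC]
    rw [h3] at h2
    refine h2.congr fun t => ?_
    ext i
    simp [imPart, h0, reC]
  have key : ∀ σ : (Fin n → ℝ) → (Fin n → ℝ), Continuous σ → (∀ (t : ℝ) w, σ (t • w) = t • σ w) →
      Tendsto (fun t => Real.arctan (mink n D (rePart n (γ t)) (σ (imPart n (γ t)))) / t)
        (nhdsWithin 0 (Set.Ioi 0)) (nhds (mink n D x (σ y))) := by
    intro σ hσ hlin
    have hP : Tendsto (fun t => mink n D (rePart n (γ t)) (σ (t⁻¹ • imPart n (γ t))))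
        (nhdsWithin 0 (Set.Ioi 0)) (nhds (mink n D x (σ y))) :=
      Tendsto.comp (g := fun q : (Fin n → ℝ) × (Fin n → ℝ) => mink n D q.1 q.2)
        (f := fun t => (rePart n (γ t), σ (t⁻¹ • imPart n (γ t))))
        (mink_cont hDopen hDconv hDbdd hx (σ y))
        (hre.prodMk_nhds ((hσ.tendsto y).comp him))
    refine (arctan_scaled hP).congr' ?_
    filter_upwards [self_mem_nhdsWithin, hre (hDopen.mem_nhds hx)] with t ht hD
    have ht : 0 < t := ht
    rw [← mink_smul' hDopen hDconv hD _ ht, ← hlin, smul_smul, mul_inv_cancel₀ ht.ne', one_smul]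
  have k1 := key id continuous_id (fun _ _ => rfl)
  have k2 := key (fun w => -w) continuous_neg (fun t w => by simp)
  refine ((k1.add k2).div_const 2).congr fun t => ?_
  simp only [ellTubeU, minkP, rePart_conjC, imPart_conjC, id]
  ring

lemma le_EInf_U {D : Set (Fin n → ℝ)} (hDopen : IsOpen D) (hDconv : Convex ℝ D)
    (hDbdd : Bornology.IsBounded D) {x : Fin n → ℝ} (hx : x ∈ D) (y : Fin n → ℝ) :
    (((mink n D x y + mink n D x (-y)) / 2 : ℝ) : EReal) ≤
      EInf n (ellTube n D) (ellTubeU n D) x y := by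
  refine le_sInf ?_
  rintro L ⟨ε, hε, γ, -, -, h0, hγ, rfl⟩
  have := (continuous_coe_real_ereal.tendsto _).comp
    (U_curve hDopen hDconv hDbdd hx y h0 hγ)
  exact this.limsup_eq.ge

lemma schwarz_half {φ : ℂ → ℂ} {φ' : ℂ} {r : ℝ} (hr : 0 < r)
    (hd : DifferentiableOn ℂ φ (ball 0 1)) (hre : ∀ ζ ∈ ball (0:ℂ) 1, 0 < (φ ζ).re)
    (h0 : φ 0 = r) (hφ : HasDerivAt φ φ' 0) : ‖φ'‖ ≤ 2 * r := by
  have hne : ∀ ζ ∈ ball (0:ℂ) 1, φ ζ + r ≠ 0 := by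
    intro ζ hζ h
    have h1 := hre ζ hζ
    have h2 := congrArg Complex.re h
    simp at h2
    linarith
  set ψ : ℂ → ℂ := fun ζ => (φ ζ - r) / (φ ζ + r) with hψ
  have hψ0 : ψ 0 = 0 := by simp [hψ, h0]
  have hψd : DifferentiableOn ℂ ψ (ball 0 1) :=
    (hd.sub_const _).div (hd.add_const _) hne
  have hmaps : MapsTo ψ (ball 0 1) (closedBall (ψ 0) 1) := by
    intro ζ hζ
    rw [hψ0, mem_closedBall_zero_iff, hψ]
    simp only [norm_div]
    rw [div_le_one (norm_pos_iff.2 (hne ζ hζ)), ← sq_le_sq₀ (norm_nonneg _) (norm_nonneg _),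
      Complex.sq_norm, Complex.sq_norm, Complex.normSq_apply, Complex.normSq_apply]
    have := hre ζ hζ
    simp
    nlinarith [mul_pos this hr]
  have hle := Complex.norm_deriv_le_one_of_mapsTo_ball hψd hmaps one_pos
  have hder := (hφ.sub_const (r : ℂ)).div (hφ.add_const (r : ℂ)) (hne 0 (by simp))
  have hder' : deriv ψ 0 = φ' / (2 * r) := by
    have hr' : (r : ℂ) ≠ 0 := by exact_mod_cast hr.ne'
    refine (HasDerivAt.deriv hder).trans ?_
    rw [h0]
    field_simp
    ring
  rw [hder', norm_div, norm_mul, Complex.norm_real, Real.norm_of_nonneg hr.le,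
    div_le_one (by simpa using hr)] at hle
  simpa using hle

lemma le_FInf {D : Set (Fin n → ℝ)} (hDopen : IsOpen D) (hDconv : Convex ℝ D)
    (hDbdd : Bornology.IsBounded D) {x : Fin n → ℝ} (hx : x ∈ D) (y : Fin n → ℝ) :
    (((mink n D x y + mink n D x (-y)) / 2 : ℝ) : EReal) ≤
      FInf n D (ellTube n D) x y := by
  refine le_sInf ?_
  rintro L ⟨a, ha, rfl, f, hf, hfX, -, h0, hf'⟩
  rw [EReal.coe_le_coe_iff]
  by_cases hy : y = 0
  · subst hy
    rw [neg_zero, mink_zero' hx]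
    simpa using ha.le
  obtain ⟨l, m, c, d, hl, hm, e1, e2⟩ := exists_pair hDopen hDconv hDbdd hx hy
  have hApos : ∀ (k : (Fin n → ℝ) →L[ℝ] ℝ) (b : ℝ), (∀ a ∈ D, k a < b) → ∀ ζ ∈ ball (0:ℂ) 1,
      0 < ((b : ℂ) - ellC k (f ζ)).re := by
    intro k b hk ζ hζ
    have := hk _ (hfX ζ hζ).1
    simp only [sub_re, ofReal_re, ellC_re]
    linarith
  have hne : ∀ {w : ℂ}, 0 < w.re → w ≠ 0 := by
    intro w hw h; rw [h] at hw; simp at hw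
  have hdiff : ∀ (k : (Fin n → ℝ) →L[ℝ] ℝ) (b : ℝ),
      DifferentiableOn ℂ (fun ζ => (b : ℂ) - ellC k (f ζ)) (ball 0 1) := by
    intro k b
    exact ((ellC k).differentiable.comp_differentiableOn hf).const_sub _
  have hreC : ∀ (k : (Fin n → ℝ) →L[ℝ] ℝ) (w : Fin n → ℝ), ellC k (reC n w) = (k w : ℂ) := by
    intro k w
    apply Complex.ext
    · rw [ellC_re, rePart_reC, ofReal_re]
    · rw [ellC_im, imPart_reC, ofReal_im, map_zero]
  have hder : ∀ (k : (Fin n → ℝ) →L[ℝ] ℝ) (b : ℝ),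
      HasDerivAt (fun ζ => (b : ℂ) - ellC k (f ζ)) (-((a⁻¹ * k y : ℝ) : ℂ)) 0 := by
    intro k b
    have h3 := ((ellC k).hasFDerivAt.comp_hasDerivAt (0:ℂ) hf').const_sub (b : ℂ)
    have h4 : ellC k (a⁻¹ • reC n y) = ((a⁻¹ * k y : ℝ) : ℂ) := by
      have : a⁻¹ • reC n y = reC n (a⁻¹ • y) := by ext i; simp [reC]
      rw [this, hreC, map_smul, smul_eq_mul]
    rw [h4] at h3
    exact h3
  have hcx := hl x hx
  have hdx := hm x hx
  have hA : 0 < c - l x := by linarith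
  have hB : 0 < d - m x := by linarith
  have hφ := schwarz_half (φ := fun ζ => ((d : ℂ) - ellC m (f ζ)) / ((c : ℂ) - ellC l (f ζ)))
    (r := (d - m x) / (c - l x)) (div_pos hB hA)
    ((hdiff m d).div (hdiff l c) fun ζ hζ => hne (hApos l c hl ζ hζ))
    (fun ζ hζ => by
      have p1 := hApos m d hm ζ hζ
      have p2 := hApos l c hl ζ hζ
      have q1 := pair_le hDopen hl hm (hfX ζ hζ).1
      have q2 := neg_pair_le hDopen hl hm (hfX ζ hζ).1
      have q3 := U_lt (hfX ζ hζ)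
      have harg : arg (((d : ℂ) - ellC m (f ζ)) / ((c : ℂ) - ellC l (f ζ))) =
          arg ((d : ℂ) - ellC m (f ζ)) - arg ((c : ℂ) - ellC l (f ζ)) := by
        have hp2 : arg ((c : ℂ) - ellC l (f ζ)) ≠ Real.pi := by
          have h5 := abs_lt.1 (Complex.abs_arg_lt_pi_div_two_iff.2 (Or.inl p2))
          intro h6
          linarith [h5.2, Real.pi_pos]
        have hi : arg ((c : ℂ) - ellC l (f ζ))⁻¹ = -arg ((c : ℂ) - ellC l (f ζ)) := by
          rw [Complex.arg_inv, if_neg hp2]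
        rw [div_eq_mul_inv, (Complex.arg_mul_eq_add_arg_iff (hne p1) (inv_ne_zero (hne p2))).2, hi]
        · ring
        · rw [hi]
          constructor <;> linarith [Real.pi_pos]
      have habs : |arg (((d : ℂ) - ellC m (f ζ)) / ((c : ℂ) - ellC l (f ζ)))| < Real.pi / 2 := by
        rw [harg, abs_lt]
        constructor <;> linarith
      rcases Complex.abs_arg_lt_pi_div_two_iff.1 habs with h | h
      · exact h
      · exact absurd h (div_ne_zero (hne p1) (hne p2)))
    (by simp only [h0, hreC]; push_cast; rfl)
    ((hder m d).div (hder l c) (by rw [h0, hreC]; exact_mod_cast hA.ne'))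
  simp only [h0, hreC] at hφ
  rw [← e1, ← e2]
  have hval : (-((a⁻¹ * m y : ℝ) : ℂ) * ((c : ℂ) - (l x : ℂ)) - ((d : ℂ) - (m x : ℂ)) * (-((a⁻¹ * l y : ℝ) : ℂ))) / ((c : ℂ) - (l x : ℂ)) ^ 2
      = (((-(a⁻¹ * m y) * (c - l x) - (d - m x) * (-(a⁻¹ * l y))) / (c - l x) ^ 2 : ℝ) : ℂ) := by
    push_cast; rfl
  rw [hval, Complex.norm_real] at hφ
  have hφ' := (le_abs_self _).trans hφ
  rw [map_neg]
  have hq : (-(a⁻¹ * m y) * (c - l x) - (d - m x) * (-(a⁻¹ * l y))) / (c - l x) ^ 2 =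
      a⁻¹ * ((d - m x) / (c - l x)) * (l y / (c - l x) + -m y / (d - m x)) := by
    field_simp
    ring
  rw [hq] at hφ'
  have hr : 0 < (d - m x) / (c - l x) := div_pos hB hA
  generalize (d - m x) / (c - l x) = r at *
  generalize l y / (c - l x) + -m y / (d - m x) = q at *
  have : a⁻¹ * q ≤ 2 := by
    by_contra hcon
    push Not at hcon
    nlinarith
  rw [inv_mul_le_iff₀ ha] at this
  linarith

end helpers

/-- **Theorem 7.1** (metric part).  For the elliptic tube `D^ell` over a bounded open
convex domain `D ⊆ ℝⁿ`, with maximal function `u = (arctan p(z) + arctan p(z̄))/2`, one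
has, for `x ∈ D`, `y ∈ ℝⁿ = T_xD` and `z = x + iy`,
`E_{u,D^ell}(x, y) = E_{D,D^ell}(x, y) = F_{D,D^ell}(x, y) = (p(z) + p(z̄))/2`. -/
theorem ellTube_metrics
    (D : Set (Fin n → ℝ)) (hDne : D.Nonempty) (hDopen : IsOpen D)
    (hDconv : Convex ℝ D) (hDbdd : Bornology.IsBounded D)
    (x : Fin n → ℝ) (hx : x ∈ D) (y : Fin n → ℝ)
    (z : Fin n → ℂ) (hz : z = reC n x + Complex.I • reC n y) :
    EInf n (ellTube n D) (ellTubeU n D) x y =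
        (((minkP n D z + minkP n D (conjC n z)) / 2 : ℝ) : EReal) ∧
      ESup n (ellTube n D) x y =
        (((minkP n D z + minkP n D (conjC n z)) / 2 : ℝ) : EReal) ∧
      FInf n D (ellTube n D) x y =
        (((minkP n D z + minkP n D (conjC n z)) / 2 : ℝ) : EReal) := by
  have hz1 : minkP n D z = mink n D x y := by
    rw [hz, minkP, rePart_line, imPart_line]; simp
  have hz2 : minkP n D (conjC n z) = mink n D x (-y) := by
    rw [hz, minkP, rePart_conjC, imPart_conjC, rePart_line, imPart_line]; simp
  rw [hz1, hz2]
  have hup : ∀ r : ℝ, (((mink n D x y + mink n D x (-y)) / 2 : ℝ) : EReal) < r →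
      ∃ s t : ℝ, 0 < s ∧ 0 < t ∧ x + s⁻¹ • y ∈ D ∧ x - t⁻¹ • y ∈ D ∧ (s + t) / 2 = r := by
    intro r hr
    rw [EReal.coe_lt_coe_iff] at hr
    have p1 := mink_nonneg' D x y
    have p2 := mink_nonneg' D x (-y)
    refine ⟨mink n D x y + (r - (mink n D x y + mink n D x (-y)) / 2),
      mink n D x (-y) + (r - (mink n D x y + mink n D x (-y)) / 2), by linarith, by linarith,
      mink_star hDopen hDconv hx (by linarith), ?_, by ring⟩
    have := mink_star hDopen hDconv hx (y := -y)
      (t := mink n D x (-y) + (r - (mink n D x y + mink n D x (-y)) / 2)) (by linarith)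
    rwa [smul_neg, ← sub_eq_add_neg] at this
  have hE : ∀ v, MemPSHU n (ellTube n D) v → EInf n (ellTube n D) v x y ≤
      (((mink n D x y + mink n D x (-y)) / 2 : ℝ) : EReal) := by
    intro v hv
    refine EReal.le_of_forall_lt_iff_le.1 fun r hr => ?_
    obtain ⟨s, t, hs, ht, h1, h2, rfl⟩ := hup r hr
    have := EInf_le hDopen hDconv hv (inv_pos.2 ht) (inv_pos.2 hs) h1 h2
    rwa [inv_inv, inv_inv, add_comm t s] at this
  have hU := U_mem hDopen hDconv hDbdd
  have hlow := le_EInf_U hDopen hDconv hDbdd hx y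
  refine ⟨le_antisymm (hE _ hU) hlow, le_antisymm ?_ ?_, le_antisymm ?_ ?_⟩
  · exact iSup₂_le fun v hv => hE v hv
  · exact hlow.trans (le_iSup₂ (f := fun (u : (Fin n → ℂ) → ℝ)
      (_ : u ∈ {u : (Fin n → ℂ) → ℝ | MemPSHU n (ellTube n D) u}) =>
        EInf n (ellTube n D) u x y) (ellTubeU n D) hU)
  · refine EReal.le_of_forall_lt_iff_le.1 fun r hr => ?_
    obtain ⟨s, t, hs, ht, h1, h2, rfl⟩ := hup r hr
    exact FInf_le hDconv hs ht h1 h2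
  · exact le_FInf hDopen hDconv hDbdd hx y
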